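/- Let Φ = {φ_j}_{j=1}^N be a self-similar system on ℝ^m satisfying the open set condition, with infinite attractor F and scaling vector r; set D := D_r, x_1 := sup{x > 0 : N_B(F,x) = 1}, and L(x) := N_B(F,x) − ∑_{j=1}^N N_B(F, r_j x). Suppose that ∫_{x_1}^∞ |L(x)| x^{−σ−1} dx < ∞ for every real σ > D. Then for every s ∈ ℂ with Re(s) > D (where necessarily 1 − ∑_{j=1}^N r_j^s ≠ 0), one has s·∫_{x_1}^∞ N_B(F,x) x^{−s−1} dx = x_1^{−s} + ((N−1)·x_1^{−s} + E(s))/(1 − ∑_{j=1}^N r_j^s), where E(s) := s·∫_{x_1}^∞ L(x) x^{−s−1} dx. -/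

import Mathlib

open Filter Topology Metric MeasureTheory

/-- The box-counting function `N_B(A,x)`: the maximal number of pairwise disjoint closed
balls of radius `x⁻¹` whose centers lie in `A`. -/
noncomputable def boxCount {m : ℕ} (A : Set (EuclideanSpace ℝ (Fin m))) (x : ℝ) : ℕ :=
  sSup {n : ℕ | ∃ c : Fin n → EuclideanSpace ℝ (Fin m), (∀ i, c i ∈ A) ∧
    Pairwise fun i j => Disjoint (closedBall (c i) x⁻¹) (closedBall (c j) x⁻¹)}

/-- `φ` is a contracting similarity with scaling ratio `ρ`. -/
def IsSimilarity {X : Type*} [MetricSpace X] (φ : X → X) (ρ : ℝ) : Prop :=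
  ∀ x y, dist (φ x) (φ y) = ρ * dist x y

section BoxCounting

variable {m : ℕ} {A : Set (EuclideanSpace ℝ (Fin m))}

/-- The cardinalities of packings of `A` by disjoint closed balls of a fixed radius are bounded. -/
theorem bddAbove_packing (hA : TotallyBounded A) {x : ℝ} (hx : 0 < x) :
    BddAbove {n : ℕ | ∃ c : Fin n → EuclideanSpace ℝ (Fin m), (∀ i, c i ∈ A) ∧
      Pairwise fun i j => Disjoint (closedBall (c i) x⁻¹) (closedBall (c j) x⁻¹)} := by
  obtain ⟨t, ht, hcov⟩ := Metric.totallyBounded_iff.1 hA x⁻¹ (inv_pos.2 hx)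
  refine ⟨ht.toFinset.card, ?_⟩
  rintro n ⟨c, hc, hdisj⟩
  have h : ∀ i, ∃ y ∈ t, dist (c i) y < x⁻¹ := fun i => by
    simpa using hcov (hc i)
  choose y hyt hy using h
  have hinj : Function.Injective y := by
    intro i j hij
    by_contra hne
    refine (hdisj hne).notMem_of_mem_left (a := y i) ?_ ?_
    · simpa [dist_comm] using (hy i).le
    · simpa [dist_comm, hij] using (hy j).le
  simpa using Finset.card_le_card_of_injOn (s := Finset.univ) (t := ht.toFinset) y
    (by simpa using hyt) hinj.injOn

theorem le_boxCount (hA : TotallyBounded A) {x : ℝ} (hx : 0 < x) {n : ℕ}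
    (c : Fin n → EuclideanSpace ℝ (Fin m)) (hc : ∀ i, c i ∈ A)
    (hdisj : Pairwise fun i j => Disjoint (closedBall (c i) x⁻¹) (closedBall (c j) x⁻¹)) :
    n ≤ boxCount A x :=
  le_csSup (bddAbove_packing hA hx) ⟨c, hc, hdisj⟩

theorem one_le_boxCount (hA : TotallyBounded A) (hne : A.Nonempty) {x : ℝ} (hx : 0 < x) :
    1 ≤ boxCount A x := by
  obtain ⟨a, ha⟩ := hne
  exact le_boxCount hA hx (fun _ : Fin 1 => a) (fun _ => ha)
    (fun i j hij => (hij (Subsingleton.elim i j)).elim)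

theorem boxCount_mono (hA : TotallyBounded A) {x y : ℝ} (hx : 0 < x) (hxy : x ≤ y) :
    boxCount A x ≤ boxCount A y := by
  have hinv : y⁻¹ ≤ x⁻¹ := inv_anti₀ hx hxy
  refine csSup_le' ?_
  rintro n ⟨c, hc, hdisj⟩
  exact le_boxCount hA (hx.trans_le hxy) c hc fun i j hij =>
    (hdisj hij).mono (closedBall_subset_closedBall hinv) (closedBall_subset_closedBall hinv)

theorem boxCount_le_one (hA : Bornology.IsBounded A) {x : ℝ} (hx : diam A ≤ x⁻¹) :
    boxCount A x ≤ 1 := by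
  refine csSup_le' ?_
  rintro n ⟨c, hc, hdisj⟩
  by_contra! hn
  have hne : (⟨0, by omega⟩ : Fin n) ≠ ⟨1, hn⟩ := by simp
  refine (hdisj hne).notMem_of_mem_left (a := c ⟨1, hn⟩) ?_ ?_
  · exact (dist_le_diam_of_mem hA (hc _) (hc _)).trans hx
  · exact mem_closedBall_self (diam_nonneg.trans hx)

theorem two_le_boxCount (hA : TotallyBounded A) {a b : EuclideanSpace ℝ (Fin m)} (ha : a ∈ A)
    (hb : b ∈ A) {x : ℝ} (hx : 0 < x) (hab : x⁻¹ + x⁻¹ < dist a b) : 2 ≤ boxCount A x := by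
  have h := closedBall_disjoint_closedBall hab
  refine le_boxCount hA hx ![a, b] ?_ ?_
  · simp [Fin.forall_fin_two, ha, hb]
  · intro i j hij
    fin_cases i <;> fin_cases j <;> simp_all [disjoint_comm]

theorem bddAbove_boxCount_eq_one (hA : TotallyBounded A) (hnt : A.Nontrivial) :
    BddAbove {x : ℝ | 0 < x ∧ boxCount A x = 1} := by
  obtain ⟨a, ha, b, hb, hab⟩ := hnt
  have hd : 0 < dist a b := dist_pos.2 hab
  refine ⟨2 / dist a b, ?_⟩
  rintro x ⟨hx, h1⟩
  by_contra! h
  have := two_le_boxCount hA ha hb hx (by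
    rw [div_lt_iff₀ hd] at h
    rw [← two_mul, ← div_eq_mul_inv, div_lt_iff₀ hx]
    linarith)
  omega

theorem exists_boxCount_eq_one (hA : TotallyBounded A) (hne : A.Nonempty) :
    ∃ x : ℝ, 0 < x ∧ boxCount A x = 1 := by
  have hd : 0 < diam A + 1 := by linarith [diam_nonneg (s := A)]
  refine ⟨(diam A + 1)⁻¹, inv_pos.2 hd, le_antisymm ?_ (one_le_boxCount hA hne (inv_pos.2 hd))⟩
  exact boxCount_le_one hA.isBounded (by rw [inv_inv]; linarith)

theorem sSup_boxCount_eq_one_pos (hA : TotallyBounded A) (hnt : A.Nontrivial) :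
    0 < sSup {x : ℝ | 0 < x ∧ boxCount A x = 1} := by
  obtain ⟨x, hx⟩ := exists_boxCount_eq_one hA hnt.nonempty
  exact hx.1.trans_le (le_csSup (bddAbove_boxCount_eq_one hA hnt) hx)

theorem boxCount_eq_one_of_lt_sSup (hA : TotallyBounded A) (hne : A.Nonempty) {x : ℝ}
    (hx : 0 < x) (hlt : x < sSup {x : ℝ | 0 < x ∧ boxCount A x = 1}) : boxCount A x = 1 := by
  obtain ⟨y, hy, hxy⟩ := exists_lt_of_lt_csSup (exists_boxCount_eq_one hA hne) hlt
  exact le_antisymm ((boxCount_mono hA hx hxy.le).trans hy.2.le) (one_le_boxCount hA hne hx)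

end BoxCounting

theorem sum_rpow_lt_one {ι : Type*} [Fintype ι] {r : ι → ℝ} (hr : ∀ j, r j ∈ Set.Ioo (0 : ℝ) 1)
    {D σ : ℝ} (hD : ∑ j, r j ^ D = 1) (hσ : D < σ) : ∑ j, r j ^ σ < 1 := by
  rw [← hD]
  refine Finset.sum_lt_sum_of_nonempty ?_ fun j _ =>
    Real.rpow_lt_rpow_of_exponent_gt (hr j).1 (hr j).2 hσ
  by_contra h
  rw [Finset.not_nonempty_iff_eq_empty] at h
  simp [h] at hD

theorem one_sub_sum_cpow_ne_zero {ι : Type*} [Fintype ι] {r : ι → ℝ}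
    (hr : ∀ j, r j ∈ Set.Ioo (0 : ℝ) 1) {D : ℝ} (hD : ∑ j, r j ^ D = 1) {s : ℂ}
    (hs : D < s.re) : 1 - ∑ j, (r j : ℂ) ^ s ≠ 0 := by
  intro h
  have hle : ‖∑ j, (r j : ℂ) ^ s‖ ≤ ∑ j, r j ^ s.re :=
    (norm_sum_le _ _).trans_eq <| Finset.sum_congr rfl fun j _ =>
      Complex.norm_cpow_eq_rpow_re_of_pos (hr j).1 s
  rw [← sub_eq_zero.1 h, norm_one] at hle
  linarith [sum_rpow_lt_one hr hD hs]

theorem sum_rpow_eq_one_exponent_pos {N : ℕ} (hN : 2 ≤ N) {r : Fin N → ℝ}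
    (hr : ∀ j, r j ∈ Set.Ioo (0 : ℝ) 1) {D : ℝ} (hD : ∑ j, r j ^ D = 1) : 0 < D := by
  by_contra! h
  have h1 : ∑ _j : Fin N, (1 : ℝ) ≤ ∑ j, r j ^ D := Finset.sum_le_sum fun j _ =>
    Real.one_le_rpow_of_pos_of_le_one_of_nonpos (hr j).1 (hr j).2.le h
  have h2 : (2 : ℝ) ≤ N := by exact_mod_cast hN
  simp at h1
  linarith

section Renewal

variable {f : ℝ → ℝ}

theorem MonotoneOn.intervalIntegrable_mul_rpow (hf : MonotoneOn f (Set.Ioi 0)) (τ : ℝ)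
    {a b : ℝ} (ha : 0 < a) (hb : 0 < b) :
    IntervalIntegrable (fun x => f x * x ^ τ) volume a b := by
  have hsub : Set.uIcc a b ⊆ Set.Ioi 0 := fun x hx => (lt_min ha hb).trans_le hx.1
  exact (hf.mono hsub).intervalIntegrable.mul_continuousOn fun x hx =>
    (Real.continuousAt_rpow_const _ _ (Or.inl (hsub hx).ne')).continuousWithinAt

theorem integral_comp_mul_left_mul_rpow_le (hf : MonotoneOn f (Set.Ioi 0))
    (hf0 : ∀ x, 0 ≤ f x) {ρ : ℝ} (hρ : ρ ∈ Set.Ioo (0 : ℝ) 1) {a b : ℝ} (ha : 0 < a)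
    (hab : a ≤ b) (σ : ℝ) :
    ∫ x in a..b, f (ρ * x) * x ^ (-σ - 1) ≤
      ρ ^ σ * ((∫ x in (ρ * a)..a, f x * x ^ (-σ - 1)) + ∫ x in a..b, f x * x ^ (-σ - 1)) := by
  have hρ0 := hρ.1
  have hb := ha.trans_le hab
  have hscale : ∀ x ∈ Set.uIcc a b, f (ρ * x) * x ^ (-σ - 1) =
      ρ ^ (σ + 1) * (f (ρ * x) * (ρ * x) ^ (-σ - 1)) := by
    intro x hx
    have hx0 : 0 < x := (lt_min ha hb).trans_le hx.1
    have : ρ ^ (σ + 1) * ρ ^ (-σ - 1) = 1 := by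
      rw [← Real.rpow_add hρ0]; simp
    rw [Real.mul_rpow hρ0.le hx0.le]
    linear_combination (-(f (ρ * x) * x ^ (-σ - 1))) * this
  rw [intervalIntegral.integral_congr hscale, intervalIntegral.integral_const_mul,
    intervalIntegral.integral_comp_mul_left (fun u => f u * u ^ (-σ - 1)) hρ0.ne', smul_eq_mul,
    ← mul_assoc, Real.rpow_add_one hρ0.ne', mul_assoc (ρ ^ σ), mul_inv_cancel₀ hρ0.ne', mul_one]
  refine mul_le_mul_of_nonneg_left ?_ (Real.rpow_nonneg hρ0.le σ)
  have hint {c d : ℝ} := hf.intervalIntegrable_mul_rpow (-σ - 1) (a := c) (b := d)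
  have hρa := mul_pos hρ0 ha
  have hρb := mul_pos hρ0 hb
  have hρb' : ρ * b ≤ b := mul_le_of_le_one_left hb.le hρ.2.le
  rw [intervalIntegral.integral_add_adjacent_intervals (hint hρa ha) (hint ha hb),
    ← intervalIntegral.integral_add_adjacent_intervals (hint hρa hρb) (hint hρb hb)]
  refine le_add_of_nonneg_right (intervalIntegral.integral_nonneg hρb' fun x hx => ?_)
  exact mul_nonneg (hf0 x) (Real.rpow_nonneg (hρb.le.trans hx.1) _)

/-- A nonnegative monotone function whose renewal defect is integrable against `x ^ (-σ - 1)` is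
itself integrable against it, as soon as `∑ r_j ^ σ < 1`. -/
theorem integrableOn_mul_rpow_of_renewal {ι : Type*} [Fintype ι] {r : ι → ℝ}
    (hr : ∀ j, r j ∈ Set.Ioo (0 : ℝ) 1) (hf : MonotoneOn f (Set.Ioi 0)) (hf0 : ∀ x, 0 ≤ f x)
    {a σ : ℝ} (ha : 0 < a) (hσ : ∑ j, r j ^ σ < 1)
    (hint : IntegrableOn (fun x => (f x - ∑ j, f (r j * x)) * x ^ (-σ - 1)) (Set.Ioi a)) :
    IntegrableOn (fun x => f x * x ^ (-σ - 1)) (Set.Ioi a) := by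
  set l : ℝ → ℝ := fun x => (f x - ∑ j, f (r j * x)) * x ^ (-σ - 1) with hl
  set C : ι → ℝ := fun j => ∫ x in (r j * a)..a, f x * x ^ (-σ - 1)
  refine integrableOn_Ioi_of_intervalIntegral_norm_bounded
    (((∫ x in Set.Ioi a, ‖l x‖) + ∑ j, r j ^ σ * C j) / (1 - ∑ j, r j ^ σ)) a
    (b := id) (l := atTop) (fun T => ?_) tendsto_id ?_
  · rcases le_or_gt a T with h | h
    · exact (hf.intervalIntegrable_mul_rpow _ ha (ha.trans_le h)).1
    · simp [Set.Ioc_eq_empty_of_le h.le]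
  filter_upwards [eventually_ge_atTop a] with T hT
  have hT0 := ha.trans_le hT
  have hnorm : ∫ x in a..T, ‖f x * x ^ (-σ - 1)‖ = ∫ x in a..T, f x * x ^ (-σ - 1) :=
    intervalIntegral.integral_congr fun x hx => Real.norm_of_nonneg <|
      mul_nonneg (hf0 x) (Real.rpow_nonneg ((lt_min ha hT0).trans_le hx.1).le _)
  have hfj (j : ι) : IntervalIntegrable (fun x => f (r j * x) * x ^ (-σ - 1)) volume a T := by
    have hmono : MonotoneOn (fun x => f (r j * x)) (Set.Ioi 0) := fun x hx y hy hxy =>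
      hf (mul_pos (hr j).1 hx) (mul_pos (hr j).1 hy) (mul_le_mul_of_nonneg_left hxy (hr j).1.le)
    exact hmono.intervalIntegrable_mul_rpow _ ha hT0
  have hlT : IntervalIntegrable l volume a T :=
    (intervalIntegrable_iff_integrableOn_Ioc_of_le hT).2 (hint.mono_set Set.Ioc_subset_Ioi_self)
  have hsplit : ∫ x in a..T, f x * x ^ (-σ - 1) =
      (∫ x in a..T, l x) + ∑ j, ∫ x in a..T, f (r j * x) * x ^ (-σ - 1) := by
    rw [← intervalIntegral.integral_finsetSum fun j _ => hfj j,
      ← intervalIntegral.integral_add hlT (by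
        simpa [Finset.sum_fn] using IntervalIntegrable.sum Finset.univ fun j _ => hfj j)]
    refine intervalIntegral.integral_congr fun x _ => ?_
    simp only [hl, ← Finset.sum_mul]
    ring
  have hlle : ∫ x in a..T, l x ≤ ∫ x in Set.Ioi a, ‖l x‖ := by
    rw [intervalIntegral.integral_of_le hT]
    refine (Real.le_norm_self _).trans ((norm_integral_le_integral_norm _).trans ?_)
    exact setIntegral_mono_set hint.norm (ae_of_all _ fun x => norm_nonneg _)
      (ae_of_all _ Set.Ioc_subset_Ioi_self)
  have hsum : ∑ j, ∫ x in a..T, f (r j * x) * x ^ (-σ - 1) ≤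
      ∑ j, r j ^ σ * (C j + ∫ x in a..T, f x * x ^ (-σ - 1)) :=
    Finset.sum_le_sum fun j _ => integral_comp_mul_left_mul_rpow_le hf hf0 (hr j) ha hT σ
  simp only [mul_add, Finset.sum_add_distrib, ← Finset.sum_mul] at hsum
  rw [id, hnorm, le_div_iff₀ (by linarith)]
  linarith

theorem MonotoneOn.integrableOn_mul_cpow (hf : MonotoneOn f (Set.Ioi 0)) {a : ℝ} (ha : 0 < a)
    {s : ℂ} (hint : IntegrableOn (fun x => f x * x ^ (-s.re - 1)) (Set.Ioi a)) :
    IntegrableOn (fun x => (f x : ℂ) * (x : ℂ) ^ (-s - 1)) (Set.Ioi a) := by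
  have hsub : Set.Ioi a ⊆ Set.Ioi 0 := Set.Ioi_subset_Ioi ha.le
  refine Integrable.mono hint ?_ ?_
  · refine AEStronglyMeasurable.mul ?_ ?_
    · exact (Complex.measurable_ofReal.comp_aemeasurable (aemeasurable_restrict_of_monotoneOn
        measurableSet_Ioi (hf.mono hsub))).aestronglyMeasurable
    · refine ContinuousOn.aestronglyMeasurable (fun x hx => ?_) measurableSet_Ioi
      exact (Complex.continuousAt_ofReal_cpow_const x _
        (Or.inr (hsub hx).ne')).continuousWithinAt
  · refine (ae_restrict_mem measurableSet_Ioi).mono fun x hx => le_of_eq ?_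
    rw [norm_mul, norm_mul, Complex.norm_cpow_eq_rpow_re_of_pos (hsub hx), Complex.norm_real,
      Real.norm_of_nonneg (Real.rpow_nonneg (le_of_lt (hsub hx)) (-s.re - 1))]
    simp

/-- Change of variables in the truncated Mellin integral of a function equal to `1` near `0`. -/
theorem integral_Ioi_comp_mul_left_mul_cpow {a : ℝ} (ha : 0 < a)
    (hf1 : ∀ x, 0 < x → x < a → f x = 1) {ρ : ℝ} (hρ : ρ ∈ Set.Ioo (0 : ℝ) 1) {s : ℂ}
    (hs : s ≠ 0) (hint : IntegrableOn (fun x => (f x : ℂ) * (x : ℂ) ^ (-s - 1)) (Set.Ioi a)) :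
    IntegrableOn (fun x => (f (ρ * x) : ℂ) * (x : ℂ) ^ (-s - 1)) (Set.Ioi a) ∧
      s * ∫ x in Set.Ioi a, (f (ρ * x) : ℂ) * (x : ℂ) ^ (-s - 1) =
        (a : ℂ) ^ (-s) * (1 - (ρ : ℂ) ^ s) +
          (ρ : ℂ) ^ s * (s * ∫ x in Set.Ioi a, (f x : ℂ) * (x : ℂ) ^ (-s - 1)) := by
  have hρ0 := hρ.1
  have hρc : (ρ : ℂ) ≠ 0 := by exact_mod_cast hρ0.ne'
  have hρa := mul_pos hρ0 ha
  have hle : ρ * a ≤ a := mul_le_of_le_one_left ha.le hρ.2.le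
  set g : ℝ → ℂ := fun x => (f x : ℂ) * (x : ℂ) ^ (-s - 1) with hg
  have hscale : Set.EqOn (fun x : ℝ => (f (ρ * x) : ℂ) * (x : ℂ) ^ (-s - 1))
      (fun x => (ρ : ℂ) ^ (s + 1) * g (ρ * x)) (Set.Ioi a) := by
    intro x hx
    have hx0 : 0 < x := ha.trans hx
    have : (ρ : ℂ) ^ (s + 1) * (ρ : ℂ) ^ (-s - 1) = 1 := by
      rw [← Complex.cpow_add _ _ hρc]; simp
    simp only [hg]
    push_cast
    rw [Complex.mul_cpow_ofReal_nonneg hρ0.le hx0.le]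
    linear_combination (-((f (ρ * x) : ℂ) * (x : ℂ) ^ (-s - 1))) * this
  have hzero : (0 : ℝ) ∉ Set.uIcc (ρ * a) a := fun h => by
    rw [Set.uIcc_of_le hle] at h; linarith [h.1]
  have heq : ∀ᵐ x : ℝ, x ∈ Set.Ioc (ρ * a) a → (x : ℂ) ^ (-s - 1) = g x := by
    filter_upwards [Measure.ae_ne volume a] with x hxa hx
    simp [hg, hf1 x (hρa.trans hx.1) (lt_of_le_of_ne hx.2 hxa)]
  have hcpow : IntervalIntegrable (fun x : ℝ => (x : ℂ) ^ (-s - 1)) volume (ρ * a) a :=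
    intervalIntegral.intervalIntegrable_cpow (Or.inr hzero)
  have hsmall : IntegrableOn g (Set.Ioc (ρ * a) a) :=
    ((intervalIntegrable_iff_integrableOn_Ioc_of_le hle).1 hcpow).congr_fun_ae
      ((ae_restrict_iff' measurableSet_Ioc).2 heq)
  have hunion : Set.Ioc (ρ * a) a ∪ Set.Ioi a = Set.Ioi (ρ * a) := Set.Ioc_union_Ioi_eq_Ioi hle
  have hbig : IntegrableOn g (Set.Ioi (ρ * a)) := hunion ▸ hsmall.union hint
  refine ⟨?_, ?_⟩
  · rw [integrableOn_congr_fun hscale measurableSet_Ioi]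
    exact ((integrableOn_Ioi_comp_mul_left_iff g a hρ0).2 hbig).const_mul _
  have hI : s * ∫ x in Set.Ioc (ρ * a) a, g x = (ρ * a : ℂ) ^ (-s) - (a : ℂ) ^ (-s) := by
    rw [← setIntegral_congr_ae measurableSet_Ioc heq, ← intervalIntegral.integral_of_le hle,
      integral_cpow (Or.inr ⟨by simpa [sub_eq_iff_eq_add] using hs, hzero⟩)]
    simp only [sub_add_cancel]
    push_cast
    field_simp
    ring
  have hpow : (ρ : ℂ) ^ s * (ρ : ℂ) ^ (-s) = 1 := by
    rw [← Complex.cpow_add _ _ hρc]; simp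
  rw [setIntegral_congr_fun measurableSet_Ioi hscale, integral_const_mul,
    integral_comp_mul_left_Ioi g a hρ0, ← hunion,
    setIntegral_union (Set.Ioc_disjoint_Ioi le_rfl) measurableSet_Ioi hsmall hint,
    Complex.cpow_add _ _ hρc, Complex.cpow_one, Complex.real_smul, Complex.ofReal_inv]
  rw [Complex.mul_cpow_ofReal_nonneg hρ0.le ha.le] at hI
  have hcancel : (ρ : ℂ) * (ρ : ℂ)⁻¹ = 1 := mul_inv_cancel₀ hρc
  linear_combination (ρ : ℂ) ^ s * hI + (a : ℂ) ^ (-s) * hpow +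
    (ρ : ℂ) ^ s * s * ((∫ x in Set.Ioc (ρ * a) a, g x) + ∫ x in Set.Ioi a, g x) * hcancel

end Renewal

/-- Closed form for the box-counting zeta function of a self-similar set satisfying the open
set condition: if the error term `L` of the renewal equation is absolutely integrable against
`x^{-σ-1}` for every real `σ > D`, then for `Re s > D` the denominator `1 - ∑ r_j^s` is
nonzero and
`s ∫_{x₁}^∞ N_B(F,x) x^{-s-1} dx = x₁^{-s} + ((N-1) x₁^{-s} + E(s)) / (1 - ∑ r_j^s)`,
where `E(s) = s ∫_{x₁}^∞ L(x) x^{-s-1} dx`. -/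
theorem stmt14 {m N : ℕ} (hN : 2 ≤ N)
    (φ : Fin N → EuclideanSpace ℝ (Fin m) → EuclideanSpace ℝ (Fin m))
    (r : Fin N → ℝ) (hr : ∀ j, r j ∈ Set.Ioo (0 : ℝ) 1)
    (hsim : ∀ j, IsSimilarity (φ j) (r j))
    (hOSC : ∃ V : Set (EuclideanSpace ℝ (Fin m)), V.Nonempty ∧ IsOpen V ∧
      (∀ j, φ j '' V ⊆ V) ∧ Pairwise fun i j => Disjoint (φ i '' V) (φ j '' V))
    (F : Set (EuclideanSpace ℝ (Fin m)))
    (hFne : F.Nonempty) (hFc : IsCompact F) (hFinv : F = ⋃ j, φ j '' F)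
    (hFinfinite : F.Infinite)
    (D : ℝ) (hD : ∑ j, r j ^ D = 1)
    (x₁ : ℝ) (hx₁ : x₁ = sSup {x : ℝ | 0 < x ∧ boxCount F x = 1})
    (L : ℝ → ℝ) (hL : ∀ x, L x = (boxCount F x : ℝ) - ∑ j, (boxCount F (r j * x) : ℝ))
    (hint : ∀ σ : ℝ, D < σ →
      MeasureTheory.IntegrableOn (fun x : ℝ => L x * x ^ (-σ - 1)) (Set.Ioi x₁)) :
    ∀ s : ℂ, D < s.re →
      (1 - ∑ j, ((r j : ℂ)) ^ s ≠ 0) ∧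
      s * (∫ x in Set.Ioi x₁, (boxCount F x : ℂ) * (x : ℂ) ^ (-s - 1)) =
        (x₁ : ℂ) ^ (-s) +
          (((N : ℂ) - 1) * (x₁ : ℂ) ^ (-s) +
              s * (∫ x in Set.Ioi x₁, (L x : ℂ) * (x : ℂ) ^ (-s - 1))) /
            (1 - ∑ j, ((r j : ℂ)) ^ s) := by
  intro s hs
  have hden := one_sub_sum_cpow_ne_zero hr hD hs
  refine ⟨hden, ?_⟩
  have hs0 : s ≠ 0 := by
    rintro rfl
    exact lt_asymm (sum_rpow_eq_one_exponent_pos hN hr hD) hs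
  have hF := hFc.totallyBounded
  have hx0 : 0 < x₁ := hx₁ ▸ sSup_boxCount_eq_one_pos hF hFinfinite.nontrivial
  set f : ℝ → ℝ := fun x => boxCount F x with hfdef
  have hf : MonotoneOn f (Set.Ioi 0) := fun x hx y _ hxy =>
    Nat.cast_le.2 (boxCount_mono hF hx hxy)
  have hf1 : ∀ x, 0 < x → x < x₁ → f x = 1 := fun x hx hlt => by
    simp [hfdef, boxCount_eq_one_of_lt_sSup hF hFne hx (hx₁ ▸ hlt)]
  have hreal := integrableOn_mul_rpow_of_renewal hr hf (fun x => Nat.cast_nonneg _) hx0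
    (sum_rpow_lt_one hr hD hs) (by simpa only [hL] using hint s.re hs)
  have hfc := hf.integrableOn_mul_cpow hx0 hreal
  have hfj j := integral_Ioi_comp_mul_left_mul_cpow hx0 hf1 (hr j) hs0 hfc
  have hLint : ∫ x in Set.Ioi x₁, (L x : ℂ) * (x : ℂ) ^ (-s - 1) =
      (∫ x in Set.Ioi x₁, (f x : ℂ) * (x : ℂ) ^ (-s - 1)) -
        ∑ j, ∫ x in Set.Ioi x₁, (f (r j * x) : ℂ) * (x : ℂ) ^ (-s - 1) := by
    rw [← integral_finsetSum _ fun j _ => (hfj j).1,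
      ← integral_sub hfc (integrable_finsetSum _ fun j _ => (hfj j).1)]
    refine integral_congr_ae (ae_of_all _ fun x => ?_)
    simp only [hL, hfdef, ← Finset.sum_mul]
    push_cast
    ring
  have hsum := Finset.sum_congr (rfl : (Finset.univ : Finset (Fin N)) = _) fun j _ => (hfj j).2
  rw [Finset.sum_add_distrib, ← Finset.mul_sum, ← Finset.mul_sum, ← Finset.sum_mul,
    Finset.sum_sub_distrib] at hsum
  simp only [Finset.sum_const, Finset.card_univ, Fintype.card_fin, nsmul_eq_mul, mul_one] at hsum
  have hcast : ∫ x in Set.Ioi x₁, (boxCount F x : ℂ) * (x : ℂ) ^ (-s - 1) =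
      ∫ x in Set.Ioi x₁, (f x : ℂ) * (x : ℂ) ^ (-s - 1) := by simp [hfdef]
  rw [hcast, hLint, ← sub_eq_iff_eq_add', eq_div_iff hden]
  linear_combination hsum
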